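/- Let μ be a measure (finitely supported, nonnegative) on ℤ × ℤ with μ(Γ) ≠ 0, (D₀μ)(Γ) ≠ 0 and (D₁D₀μ)(Γ) ≠ 0. Then E_{D₁D₀μ}[a] = ((D₀μ)(Γ)/(D₁D₀μ)(Γ)) · ( (m+n+1)·E_{D₀μ}[a] + 2·Cov_{D₀μ}(a, a−b) ). -/

import Mathlib

open Finsupp Filter

noncomputable section

/-- Signed-sum convention: `signedSum c k = Σ_{i=0}^{k} c i`, which is the ordinary sum for
`k ≥ 0`, is `0` for `k = -1`, and equals `-(c (-1) + c (-2) + ⋯ + c (k+1))` for `k ≤ -2`. -/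
def signedSum {M : Type*} [AddCommGroup M] (c : ℤ → M) (k : ℤ) : M :=
  (∑ i ∈ Finset.range (k + 1).toNat, c i) -
    ∑ i ∈ Finset.range (-(k + 1)).toNat, c (-((i : ℤ) + 1))

/-- The Demazure operator `D₀` (relative to `Λ = mΛ₀ + nΛ₁`):
`D₀ δ_{(a,b)} = Σ_{i=0}^{m - 2(a-b)} δ_{(a+i,b)}`, extended ℤ-linearly. -/
def D0 (m : ℕ) (μ : ℤ × ℤ →₀ ℤ) : ℤ × ℤ →₀ ℤ :=
  μ.sum fun p c =>
    c • signedSum (fun i => Finsupp.single (p.1 + i, p.2) (1 : ℤ)) ((m : ℤ) - 2 * (p.1 - p.2))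

/-- The Demazure operator `D₁` (relative to `Λ = mΛ₀ + nΛ₁`):
`D₁ δ_{(a,b)} = Σ_{i=0}^{n + 2(a-b)} δ_{(a,b+i)}`, extended ℤ-linearly. -/
def D1 (n : ℕ) (μ : ℤ × ℤ →₀ ℤ) : ℤ × ℤ →₀ ℤ :=
  μ.sum fun p c =>
    c • signedSum (fun i => Finsupp.single (p.1, p.2 + i) (1 : ℤ)) ((n : ℤ) + 2 * (p.1 - p.2))

/-- Total mass `μ(Γ)` of a finitely supported function on `ℤ × ℤ`. -/
def mass (μ : ℤ × ℤ →₀ ℤ) : ℤ := μ.sum fun _ c => c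

/-- Expected value `E_ν[f] = (1/ν(Γ)) Σ ν(a,b) f(a,b)`. -/
def expVal (ν : ℤ × ℤ →₀ ℤ) (f : ℤ × ℤ → ℚ) : ℚ :=
  (mass ν : ℚ)⁻¹ * ν.sum fun p c => (c : ℚ) * f p

/-- Covariance `Cov_ν(f,g) = E_ν[f·g] - E_ν[f]·E_ν[g]`. -/
def cov (ν : ℤ × ℤ →₀ ℤ) (f g : ℤ × ℤ → ℚ) : ℚ :=
  expVal ν (fun p => f p * g p) - expVal ν f * expVal ν g

/-- Variance `Var_ν(f) = Cov_ν(f,f)`. -/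
def var (ν : ℤ × ℤ →₀ ℤ) (f : ℤ × ℤ → ℚ) : ℚ := cov ν f f

/-- The coordinate function `a` (the degree). -/
def fa : ℤ × ℤ → ℚ := fun p => (p.1 : ℚ)

/-- The coordinate function `b`. -/
def fb : ℤ × ℤ → ℚ := fun p => (p.2 : ℚ)

/-- The finite-weight coordinate `a - b`. -/
def fab : ℤ × ℤ → ℚ := fun p => (p.1 : ℚ) - (p.2 : ℚ)

/-- `μ_{N,0}`: start from `δ_{(0,0)}`, apply `D₀` at odd steps and `D₁` at even steps. -/
def mu0 (m n : ℕ) : ℕ → (ℤ × ℤ →₀ ℤ)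
  | 0 => Finsupp.single (0, 0) 1
  | N + 1 => if N % 2 = 0 then D0 m (mu0 m n N) else D1 n (mu0 m n N)

/-- `μ_{N,1}`: start from `δ_{(0,0)}`, apply `D₁` at odd steps and `D₀` at even steps. -/
def mu1 (m n : ℕ) : ℕ → (ℤ × ℤ →₀ ℤ)
  | 0 => Finsupp.single (0, 0) 1
  | N + 1 => if N % 2 = 0 then D1 n (mu1 m n N) else D0 m (mu1 m n N)

/-- Integration of `f : ℤ × ℤ → ℚ` against a finitely supported function, as a homomorphism. -/
def integral (f : ℤ × ℤ → ℚ) : (ℤ × ℤ →₀ ℤ) →+ ℚ :=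
  Finsupp.liftAddHom fun p => (AddMonoidHom.mulRight (f p)).comp (Int.castAddHom ℚ)

lemma integral_apply (f : ℤ × ℤ → ℚ) (ν : ℤ × ℤ →₀ ℤ) :
    integral f ν = ν.sum fun p c => (c : ℚ) * f p := by
  simp [integral, Finsupp.liftAddHom_apply, Function.comp_def]

lemma integral_single_one (f : ℤ × ℤ → ℚ) (p : ℤ × ℤ) :
    integral f (Finsupp.single p 1) = f p := by
  simp [integral]

lemma integral_add_fun (f g : ℤ × ℤ → ℚ) (ν : ℤ × ℤ →₀ ℤ) :
    integral (fun p => f p + g p) ν = integral f ν + integral g ν := by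
  simp only [integral_apply, mul_add, Finsupp.sum_add]

lemma integral_const_mul (x : ℚ) (f : ℤ × ℤ → ℚ) (ν : ℤ × ℤ →₀ ℤ) :
    integral (fun p => x * f p) ν = x * integral f ν := by
  simp only [integral_apply, Finsupp.mul_sum, mul_left_comm]

lemma expVal_eq (ν : ℤ × ℤ →₀ ℤ) (f : ℤ × ℤ → ℚ) :
    expVal ν f = (mass ν : ℚ)⁻¹ * integral f ν := by
  rw [integral_apply, expVal]

lemma cast_mass (ν : ℤ × ℤ →₀ ℤ) : (mass ν : ℚ) = integral (fun _ => 1) ν := by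
  simp [integral_apply, mass, Finsupp.sum]

lemma map_signedSum {M N : Type*} [AddCommGroup M] [AddCommGroup N] (φ : M →+ N)
    (c : ℤ → M) (k : ℤ) : φ (signedSum c k) = signedSum (fun i => φ (c i)) k := by
  simp [signedSum]

lemma signedSum_const (x : ℚ) (k : ℤ) : signedSum (fun _ => x) k = (k + 1) * x := by
  have h : ((k + 1).toNat : ℚ) - ((-(k + 1)).toNat : ℚ) = k + 1 := by
    exact_mod_cast Int.toNat_sub_toNat_neg (k + 1)
  simp only [signedSum, Finset.sum_const, Finset.card_range, nsmul_eq_mul, ← sub_mul, h]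

lemma two_mul_signedSum_add (x : ℚ) (k : ℤ) :
    2 * signedSum (fun i => x + i) k = (k + 1) * (2 * x + k) := by
  have hpos (N : ℕ) : 2 * ∑ i ∈ Finset.range N, (x + ((i : ℤ) : ℚ)) = N * (2 * x + N - 1) := by
    induction N with
    | zero => simp
    | succ N ih => rw [Finset.sum_range_succ, mul_add, ih]; push_cast; ring
  have hneg (N : ℕ) : 2 * ∑ i ∈ Finset.range N, (x + ((-((i : ℤ) + 1) : ℤ) : ℚ)) =
      N * (2 * x - N - 1) := by
    induction N with
    | zero => simp
    | succ N ih => rw [Finset.sum_range_succ, mul_add, ih]; push_cast; ring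
  rw [signedSum, mul_sub, hpos, hneg]
  obtain ⟨N, hN | hN⟩ := (k + 1).eq_nat_or_neg
  · obtain rfl : k = N - 1 := by lia
    simp only [hN, Int.toNat_natCast, Int.toNat_neg_natCast]
    push_cast
    ring
  · obtain rfl : k = -N - 1 := by lia
    simp only [hN, neg_neg, Int.toNat_natCast, Int.toNat_neg_natCast]
    push_cast
    ring

lemma integral_D0 (m : ℕ) (f : ℤ × ℤ → ℚ) (μ : ℤ × ℤ →₀ ℤ) :
    integral f (D0 m μ) =
      integral (fun p => signedSum (fun i => f (p.1 + i, p.2)) (m - 2 * (p.1 - p.2))) μ := by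
  rw [D0, map_finsuppSum, integral_apply]
  simp only [map_zsmul, map_signedSum, integral_single_one, zsmul_eq_mul]

lemma integral_D1 (n : ℕ) (f : ℤ × ℤ → ℚ) (μ : ℤ × ℤ →₀ ℤ) :
    integral f (D1 n μ) =
      integral (fun p => signedSum (fun i => f (p.1, p.2 + i)) (n + 2 * (p.1 - p.2))) μ := by
  rw [D1, map_finsuppSum, integral_apply]
  simp only [map_zsmul, map_signedSum, integral_single_one, zsmul_eq_mul]

/-- Each `α₀`-string is symmetric, so `a - b` has mean `m / 2` under `D₀ μ`. -/
lemma two_mul_integral_fab_D0 (m : ℕ) (μ : ℤ × ℤ →₀ ℤ) :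
    2 * integral fab (D0 m μ) = m * mass (D0 m μ) := by
  rw [cast_mass, integral_D0, integral_D0, ← integral_const_mul, ← integral_const_mul]
  congr 2
  funext p
  have h (i : ℤ) : fab (p.1 + i, p.2) = ((p.1 : ℚ) - p.2) + i := by
    simp only [fab]
    push_cast
    ring
  simp only [h, two_mul_signedSum_add, signedSum_const]
  push_cast
  ring

lemma integral_fa_D1 (n : ℕ) (ν : ℤ × ℤ →₀ ℤ) :
    integral fa (D1 n ν) =
      (n + 1) * integral fa ν + 2 * integral (fun p => fa p * fab p) ν := by
  rw [integral_D1, ← integral_const_mul, ← integral_const_mul, ← integral_add_fun]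
  congr 2
  funext p
  simp only [fa, fab, signedSum_const]
  push_cast
  ring

/-- `E_{D₁D₀μ}[a] = ((D₀μ)(Γ)/(D₁D₀μ)(Γ))((m+n+1)E_{D₀μ}[a] + 2Cov_{D₀μ}(a,a-b))`. -/
theorem stmt_7 (m n : ℕ) (μ : ℤ × ℤ →₀ ℤ) (hpos : ∀ p, 0 ≤ μ p)
    (h0 : mass μ ≠ 0) (h1 : mass (D0 m μ) ≠ 0) (h2 : mass (D1 n (D0 m μ)) ≠ 0) :
    expVal (D1 n (D0 m μ)) fa =
      (mass (D0 m μ) : ℚ) / (mass (D1 n (D0 m μ)) : ℚ) *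
        (((m : ℚ) + (n : ℚ) + 1) * expVal (D0 m μ) fa + 2 * cov (D0 m μ) fa fab) := by
  have h1' : (mass (D0 m μ) : ℚ) ≠ 0 := Int.cast_ne_zero.mpr h1
  have h2' : (mass (D1 n (D0 m μ)) : ℚ) ≠ 0 := Int.cast_ne_zero.mpr h2
  have hab := two_mul_integral_fab_D0 m μ
  simp only [cov, expVal_eq, integral_fa_D1]
  field_simp
  linear_combination (integral fa (D0 m μ)) * hab
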